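/- arXiv:2302.08745 — 3 statements merged into one kernel-verified Lean document; each statement's English description precedes it below -/
import Mathlib

section
/- Let 1 ≤ p₁ < p₂ < ∞. Then every multiplier of d_{p₁} is a multiplier of d_{p₂}, and there exists a multiplier of d_{p₂} that is not a multiplier of d_{p₁} (indeed, the sequence b with b_n = 2^{-k/p₁} when n = 2^k for some k ∈ ℕ and b_n = 0 otherwise is a multiplier of d_{p₂} but does not belong to d_{p₁}). Hence the multiplier algebra of d_{p₁} is strictly contained in that of d_{p₂}. -/
open scoped ENNReal NNReal BigOperators

/-- The `p`-th power sum defining the `d_p` (quasi-)norm: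
`∑_{n} sup_{k ≥ n} |a_k|^p`, valued in `ℝ≥0∞`. -/
noncomputable def dpSum (p : ℝ) (a : ℕ → ℂ) : ℝ≥0∞ :=
  ∑' n : ℕ, ⨆ k ∈ Set.Ici n, (‖a k‖₊ : ℝ≥0∞) ^ p

/-- The `d_p` norm `(∑_{n} sup_{k ≥ n} |a_k|^p)^{1/p}`, valued in `ℝ≥0∞`. -/
noncomputable def dpNorm (p : ℝ) (a : ℕ → ℂ) : ℝ≥0∞ := dpSum p a ^ (1 / p)

/-- Membership in the sequence space `d_p`. -/
def MemDp (p : ℝ) (a : ℕ → ℂ) : Prop := dpSum p a ≠ ⊤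

/-- Convolution of sequences: `(a*b)_n = ∑_{j=0}^n a_j b_{n-j}`. -/
noncomputable def conv (a b : ℕ → ℂ) : ℕ → ℂ :=
  fun n => ∑ j ∈ Finset.range (n + 1), a j * b (n - j)

/-- `b` is a multiplier of `d_p` if `a * b ∈ d_p` for every `a ∈ d_p`. -/
def IsMultiplier (p : ℝ) (b : ℕ → ℂ) : Prop :=
  ∀ a : ℕ → ℂ, MemDp p a → MemDp p (conv a b)

/-- The canonical sequence `e m` with a `1` in position `m` and `0` elsewhere. -/
def e (m : ℕ) : ℕ → ℂ := fun n => if n = m then 1 else 0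

/-- The right shift `S a = (0, a₀, a₁, …)`. -/
def shift (a : ℕ → ℂ) : ℕ → ℂ := fun n => match n with
  | 0 => 0
  | Nat.succ k => a k



/-- A sequence whose tails are dominated by a `p`-summable sequence belongs to `d_p`. -/
lemma memDp_of_forall_norm_le {p : ℝ} (hp : 0 < p) {a : ℕ → ℂ} {u : ℕ → ℝ} (hu : ∀ n, 0 ≤ u n)
    (hs : Summable fun n => u n ^ p) (h : ∀ n k, n ≤ k → ‖a k‖ ≤ u n) : MemDp p a := by
  refine ne_top_of_le_ne_top hs.tsum_ofReal_ne_top (ENNReal.tsum_le_tsum fun n => ?_)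
  refine iSup₂_le fun k hk => ?_
  rw [← ENNReal.ofReal_rpow_of_nonneg (hu n) hp.le]
  refine ENNReal.rpow_le_rpow ?_ hp.le
  rw [show (‖a k‖₊ : ℝ≥0∞) = ENNReal.ofReal ‖a k‖ from (ofReal_norm (a k)).symm]
  exact ENNReal.ofReal_le_ofReal (h n k hk)

/-- Every element of `d_p` has an antitone `p`-summable majorant. -/
lemma MemDp.exists_antitone_majorant {p : ℝ} (hp : 0 < p) {a : ℕ → ℂ} (ha : MemDp p a) :
    ∃ w : ℕ → ℝ, Antitone w ∧ (∀ n, 0 ≤ w n) ∧ (Summable fun n => w n ^ p) ∧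
      ∀ n, ‖a n‖ ≤ w n := by
  set g : ℕ → ℝ≥0∞ := fun n => ⨆ k ∈ Set.Ici n, (‖a k‖₊ : ℝ≥0∞) ^ p with hg
  have hsum : ∑' n, g n ≠ ⊤ := ha
  have hfin : ∀ n, g n ≠ ⊤ := ENNReal.ne_top_of_tsum_ne_top hsum
  have hanti : Antitone g := fun m n hmn =>
    biSup_mono fun k hk => hmn.trans hk
  refine ⟨fun n => (g n).toReal ^ (1 / p), fun m n hmn => ?_, fun n => by positivity, ?_,
    fun n => ?_⟩
  · exact Real.rpow_le_rpow ENNReal.toReal_nonneg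
      (ENNReal.toReal_mono (hfin m) (hanti hmn)) (by positivity)
  · refine (ENNReal.summable_toReal hsum).congr fun n => ?_
    rw [← Real.rpow_mul ENNReal.toReal_nonneg, one_div_mul_cancel hp.ne', Real.rpow_one]
  · have h1 : (‖a n‖₊ : ℝ≥0∞) ^ p ≤ g n :=
      le_iSup₂ (f := fun k (_ : k ∈ Set.Ici n) => (‖a k‖₊ : ℝ≥0∞) ^ p) n (Set.mem_Ici.2 le_rfl)
    have h2 : ‖a n‖ ^ p ≤ (g n).toReal := by
      have := ENNReal.toReal_mono (hfin n) h1
      rwa [← ENNReal.toReal_rpow, ENNReal.coe_toReal, coe_nnnorm] at this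
    calc ‖a n‖ = (‖a n‖ ^ p) ^ (1 / p) := by
          rw [← Real.rpow_mul (norm_nonneg _), mul_one_div_cancel hp.ne', Real.rpow_one]
      _ ≤ _ := Real.rpow_le_rpow (by positivity) h2 (by positivity)

/-- **Hardy's inequality**, qualitative form: the Cesàro means of a nonnegative `r`-summable
sequence are `r`-summable. -/
lemma summable_rpow_average {r : ℝ} (hr : 1 < r) {x : ℕ → ℝ} (hx : ∀ n, 0 ≤ x n)
    (hs : Summable fun n => x n ^ r) :
    Summable fun n : ℕ => ((∑ j ∈ Finset.range (n + 1), x j) / (n + 1)) ^ r := by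
  set A : ℕ → ℝ := fun n => (∑ j ∈ Finset.range (n + 1), x j) / (n + 1) with hA
  have hr0 : 0 < r := by linarith
  have hr1 : 0 < r - 1 := by linarith
  have hA0 : ∀ n, 0 ≤ A n := fun n => div_nonneg (Finset.sum_nonneg fun i _ => hx i) (by positivity)
  set q : ℝ := r / (r - 1) with hq
  have hq0 : 0 < q := div_pos hr0 hr1
  set K : ℝ := q * (2 * q) ^ (r - 1) with hK
  have hK0 : 0 ≤ K := by positivity
  have hpow : ∀ y : ℝ, 0 ≤ y → y ^ (r - 1) * y = y ^ r := fun y hy => by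
    rw [← Real.rpow_add_one' hy (by linarith), sub_add_cancel]
  have habsorb : ∀ y z : ℝ, 0 ≤ y → 0 ≤ z → q * (y ^ (r - 1) * z) ≤ y ^ r / 2 + K * z ^ r := by
    intro y z hy hz
    rcases le_total (2 * q * z) y with h | h
    · have h1 : y ^ (r - 1) * (2 * q * z) ≤ y ^ (r - 1) * y :=
        mul_le_mul_of_nonneg_left h (by positivity)
      rw [hpow y hy] at h1
      have : 0 ≤ K * z ^ r := by positivity
      nlinarith
    · have h1 : y ^ (r - 1) ≤ (2 * q) ^ (r - 1) * z ^ (r - 1) := by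
        rw [← Real.mul_rpow (by positivity) hz]
        exact Real.rpow_le_rpow hy h hr1.le
      have h2 : q * (y ^ (r - 1) * z) ≤ q * ((2 * q) ^ (r - 1) * z ^ (r - 1) * z) := by gcongr
      have h3 : q * ((2 * q) ^ (r - 1) * z ^ (r - 1) * z) = K * z ^ r := by
        rw [← hpow z hz, hK]; ring
      have : 0 ≤ y ^ r / 2 := by positivity
      linarith
  have hyoung : ∀ y z : ℝ, 0 ≤ y → 0 ≤ z →
      r * (y ^ (r - 1) * z) ≤ (r - 1) * y ^ r + z ^ r := by
    intro y z hy hz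
    have h := Real.geom_mean_le_arith_mean2_weighted (w₁ := (r - 1) / r) (w₂ := 1 / r)
      (p₁ := y ^ r) (p₂ := z ^ r) (by positivity) (by positivity) (by positivity) (by positivity)
      (by field_simp; ring)
    rw [← Real.rpow_mul hy, ← Real.rpow_mul hz, mul_div_cancel₀ _ hr0.ne',
      mul_one_div_cancel hr0.ne', Real.rpow_one] at h
    have h' := mul_le_mul_of_nonneg_left h hr0.le
    have e1 : r * ((r - 1) / r * y ^ r + 1 / r * z ^ r) = (r - 1) * y ^ r + z ^ r := by
      field_simp
    linarith
  have hzero : A 0 = x 0 := by simp [hA]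
  have hsucc : ∀ n : ℕ, ((n : ℝ) + 2) * A (n + 1) = ((n : ℝ) + 1) * A n + x (n + 1) := by
    intro n
    simp only [hA]
    rw [Finset.sum_range_succ x (n + 1)]
    push_cast
    field_simp
    ring
  have hbound : ∀ n : ℕ, ∑ k ∈ Finset.range (n + 1), A k ^ r
      + (2 / (r - 1)) * ((n : ℝ) + 1) * A n ^ r
      ≤ (2 * K + 1 + 2 / (r - 1)) * ∑ k ∈ Finset.range (n + 1), x k ^ r := by
    have hd : 0 < 2 / (r - 1) := by positivity
    intro n
    induction n with
    | zero =>
      simp only [zero_add, Finset.sum_range_one, hzero, Nat.cast_zero]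
      have : 0 ≤ K * x 0 ^ r := mul_nonneg hK0 (Real.rpow_nonneg (hx 0) r)
      nlinarith
    | succ n ih =>
      rw [Finset.sum_range_succ, Finset.sum_range_succ (fun k => x k ^ r)]
      have h1 := habsorb (A (n + 1)) (x (n + 1)) (hA0 _) (hx _)
      have h2 := hyoung (A (n + 1)) (A n) (hA0 _) (hA0 _)
      have h3 : x (n + 1) = ((n : ℝ) + 2) * A (n + 1) - ((n : ℝ) + 1) * A n := by
        linarith [hsucc n]
      have h4 : A (n + 1) ^ (r - 1) * x (n + 1) = ((n : ℝ) + 2) * A (n + 1) ^ r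
          - ((n : ℝ) + 1) * (A (n + 1) ^ (r - 1) * A n) := by
        rw [h3, mul_sub, ← hpow _ (hA0 (n + 1))]; ring
      have h5 : A (n + 1) ^ r / 2 + (1 / (r - 1)) * ((n : ℝ) + 2) * A (n + 1) ^ r
          ≤ K * x (n + 1) ^ r + (1 / (r - 1)) * ((n : ℝ) + 1) * A n ^ r := by
        rw [h4] at h1
        have h6 := mul_le_mul_of_nonneg_left h2
          (show 0 ≤ ((n : ℝ) + 1) * (1 / (r - 1)) by positivity)
        have h7 : q = 1 + 1 / (r - 1) := by rw [hq]; field_simp; ring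
        have h8 : r * (1 / (r - 1)) = q := by rw [hq]; ring
        have h9 : (r - 1) * (1 / (r - 1)) = 1 := by field_simp
        have h10 : ((n : ℝ) + 1) * (1 / (r - 1)) * (r * (A (n + 1) ^ (r - 1) * A n))
            = q * (((n : ℝ) + 1) * (A (n + 1) ^ (r - 1) * A n)) := by rw [← h8]; ring
        have h11 : ((n : ℝ) + 1) * (1 / (r - 1)) * ((r - 1) * A (n + 1) ^ r + A n ^ r)
            = ((n : ℝ) + 1) * A (n + 1) ^ r + (1 / (r - 1)) * ((n : ℝ) + 1) * A n ^ r := by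
          calc _ = ((n : ℝ) + 1) * ((r - 1) * (1 / (r - 1))) * A (n + 1) ^ r
                + (1 / (r - 1)) * ((n : ℝ) + 1) * A n ^ r := by ring
            _ = _ := by rw [h9]; ring
        rw [h10, h11] at h6
        have h12 : q * (((n : ℝ) + 2) * A (n + 1) ^ r) = ((n : ℝ) + 2) * A (n + 1) ^ r
          + (1 / (r - 1)) * ((n : ℝ) + 2) * A (n + 1) ^ r := by rw [h7]; ring
        rw [mul_sub, h12] at h1
        linarith
      have hX : 0 ≤ x (n + 1) ^ r := Real.rpow_nonneg (hx _) r
      have h13 : 2 / (r - 1) = 2 * (1 / (r - 1)) := by ring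
      have h14 : 0 < 1 / (r - 1) := by positivity
      rw [h13] at ih ⊢
      push_cast
      have h15 : 0 ≤ 1 / (r - 1) * x (n + 1) ^ r := by positivity
      nlinarith
  refine summable_of_sum_range_le (c := (2 * K + 1 + 2 / (r - 1)) * ∑' k, x k ^ r)
    (fun n => Real.rpow_nonneg (hA0 n) r) fun n => ?_
  have hC : 0 ≤ 2 * K + 1 + 2 / (r - 1) := by positivity
  calc ∑ k ∈ Finset.range n, A k ^ r ≤ ∑ k ∈ Finset.range (n + 1), A k ^ r := by
        rw [Finset.sum_range_succ]
        linarith [Real.rpow_nonneg (hA0 n) r]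
    _ ≤ (2 * K + 1 + 2 / (r - 1)) * ∑ k ∈ Finset.range (n + 1), x k ^ r := by
        have : 0 ≤ (2 / (r - 1)) * ((n : ℝ) + 1) * A n ^ r :=
          mul_nonneg (by positivity) (Real.rpow_nonneg (hA0 n) r)
        linarith [hbound n]
    _ ≤ _ := by
        gcongr
        exact hs.sum_le_tsum _ fun i _ => Real.rpow_nonneg (hx i) r

/-- A weak-type bound for convolution of `|c|` with antitone sequences. It is necessary for `c` to be
a multiplier of `d_p`, and sufficient for `c` to be a multiplier of `d_q` for all `q > p`. -/
def HasWeakConvBound (p : ℝ) (c : ℕ → ℂ) : Prop :=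
  ∃ C : ℝ, 0 ≤ C ∧ ∀ w : ℕ → ℝ, Antitone w → (∀ n, 0 ≤ w n) → ∀ k : ℕ,
    ((k : ℝ) + 1) * (∑ j ∈ Finset.range (k + 1), w j * ‖c (k - j)‖) ^ p
      ≤ C * ∑ j ∈ Finset.range (k + 1), w j ^ p

lemma norm_conv_le {a c : ℕ → ℂ} {w : ℕ → ℝ} (h : ∀ n, ‖a n‖ ≤ w n) (k : ℕ) :
    ‖conv a c k‖ ≤ ∑ j ∈ Finset.range (k + 1), w j * ‖c (k - j)‖ := by
  refine (norm_sum_le _ _).trans (Finset.sum_le_sum fun j _ => ?_)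
  rw [norm_mul]
  exact mul_le_mul_of_nonneg_right (h j) (norm_nonneg _)

/-- Marcinkiewicz-type interpolation between the weak bound at `p` and the trivial bound at `∞`. -/
lemma HasWeakConvBound.isMultiplier {p q : ℝ} (hp : 0 < p) (hpq : p < q) {c : ℕ → ℂ}
    (hc : HasWeakConvBound p c) : IsMultiplier q c := by
  obtain ⟨C, hC, hbound⟩ := hc
  have hroot : ∀ v : ℕ → ℝ, Antitone v → (∀ n, 0 ≤ v n) → ∀ k : ℕ,
      ∑ j ∈ Finset.range (k + 1), v j * ‖c (k - j)‖
        ≤ (C * (∑ j ∈ Finset.range (k + 1), v j ^ p) / (k + 1)) ^ p⁻¹ := by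
    intro v hv hv0 k
    have hs : 0 ≤ ∑ j ∈ Finset.range (k + 1), v j ^ p :=
      Finset.sum_nonneg fun j _ => Real.rpow_nonneg (hv0 j) p
    rw [Real.le_rpow_inv_iff_of_pos
      (Finset.sum_nonneg fun j _ => mul_nonneg (hv0 j) (norm_nonneg _)) (by positivity) hp,
      le_div_iff₀ (by positivity), mul_comm]
    exact hbound v hv hv0 k
  have hone : ∀ k : ℕ, ∑ j ∈ Finset.range (k + 1), ‖c (k - j)‖ ≤ C ^ p⁻¹ := by
    intro k
    have h := hroot (fun _ => 1) (fun _ _ _ => le_rfl) (fun _ => zero_le_one) k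
    have hk : (k : ℝ) + 1 ≠ 0 := by positivity
    simpa [hk] using h
  intro a ha
  obtain ⟨w, hw, hw0, hws, haw⟩ := ha.exists_antitone_majorant (hp.trans hpq)
  set H : ℕ → ℝ := fun n => (∑ j ∈ Finset.range (n + 1), w j ^ p) / (n + 1) with hH
  have hH0 : ∀ n, 0 ≤ H n := fun n =>
    div_nonneg (Finset.sum_nonneg fun j _ => Real.rpow_nonneg (hw0 j) p) (by positivity)
  have hHs : Summable fun n => H n ^ (q / p) := by
    refine summable_rpow_average ((one_lt_div hp).2 hpq) (fun n => Real.rpow_nonneg (hw0 n) p) ?_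
    refine hws.congr fun n => ?_
    rw [← Real.rpow_mul (hw0 n), mul_div_cancel₀ _ hp.ne']
  have hwH : ∀ n, w n ≤ H n ^ p⁻¹ := by
    intro n
    rw [Real.le_rpow_inv_iff_of_pos (hw0 n) (hH0 n) hp, hH, le_div_iff₀ (by positivity)]
    have h : ∑ _j ∈ Finset.range (n + 1), w n ^ p ≤ ∑ j ∈ Finset.range (n + 1), w j ^ p :=
      Finset.sum_le_sum fun j hj => Real.rpow_le_rpow (hw0 n)
        (hw (Nat.lt_succ_iff.1 (Finset.mem_range.1 hj))) hp.le
    simp only [Finset.sum_const, Finset.card_range, nsmul_eq_mul, Nat.cast_add, Nat.cast_one] at h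
    linarith
  set K : ℝ := 2 * C ^ p⁻¹ with hK
  have hK0 : 0 ≤ K := by positivity
  refine memDp_of_forall_norm_le (hp.trans hpq) (u := fun n => K * H n ^ p⁻¹)
    (fun n => mul_nonneg hK0 (Real.rpow_nonneg (hH0 n) _)) ?_ fun n k hnk => ?_
  · refine (hHs.mul_left (K ^ q)).congr fun n => ?_
    rw [Real.mul_rpow hK0 (Real.rpow_nonneg (hH0 n) _), ← Real.rpow_mul (hH0 n),
      div_eq_inv_mul]
  · set v : ℕ → ℝ := fun j => if j ≤ n then w j else 0 with hv
    have hv0 : ∀ j, 0 ≤ v j := fun j => by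
      simp only [hv]; split_ifs; exacts [hw0 j, le_rfl]
    have hva : Antitone v := by
      intro i j hij
      simp only [hv]
      split_ifs with h1 h2
      · exact hw hij
      · omega
      · exact hw0 i
      · exact le_rfl
    have hvs : ∑ j ∈ Finset.range (k + 1), v j ^ p = ∑ j ∈ Finset.range (n + 1), w j ^ p := by
      rw [← Finset.sum_subset (Finset.range_mono (Nat.succ_le_succ hnk))]
      · refine Finset.sum_congr rfl fun j hj => ?_
        have : j ≤ n := Nat.lt_succ_iff.1 (Finset.mem_range.1 hj)
        simp [hv, this]
      · intro j _ hj
        have : ¬ j ≤ n := fun h => hj (Finset.mem_range.2 (Nat.lt_succ_iff.2 h))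
        simp [hv, this, Real.zero_rpow hp.ne']
    have hwv : ∀ j, w j ≤ v j + w n := by
      intro j
      simp only [hv]
      split_ifs with h
      · linarith [hw0 n]
      · linarith [hw (le_of_not_ge h)]
    have h1 : ∑ j ∈ Finset.range (k + 1), v j * ‖c (k - j)‖ ≤ C ^ p⁻¹ * H n ^ p⁻¹ := by
      refine (hroot v hva hv0 k).trans ?_
      rw [← Real.mul_rpow hC (hH0 n), hvs, mul_div_assoc]
      simp only [hH]
      have hs : 0 ≤ ∑ j ∈ Finset.range (n + 1), w j ^ p :=
        Finset.sum_nonneg fun j _ => Real.rpow_nonneg (hw0 j) p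
      gcongr
    calc ‖conv a c k‖ ≤ ∑ j ∈ Finset.range (k + 1), w j * ‖c (k - j)‖ := norm_conv_le haw k
      _ ≤ ∑ j ∈ Finset.range (k + 1), (v j * ‖c (k - j)‖ + w n * ‖c (k - j)‖) :=
          Finset.sum_le_sum fun j _ => by
            rw [← add_mul]; exact mul_le_mul_of_nonneg_right (hwv j) (norm_nonneg _)
      _ = ∑ j ∈ Finset.range (k + 1), v j * ‖c (k - j)‖
          + w n * ∑ j ∈ Finset.range (k + 1), ‖c (k - j)‖ := by
          rw [Finset.sum_add_distrib, Finset.mul_sum]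
      _ ≤ C ^ p⁻¹ * H n ^ p⁻¹ + H n ^ p⁻¹ * C ^ p⁻¹ :=
          add_le_add h1 (mul_le_mul (hwH n) (hone k)
            (Finset.sum_nonneg fun j _ => norm_nonneg _) (Real.rpow_nonneg (hH0 n) _))
      _ = K * H n ^ p⁻¹ := by rw [hK]; ring

/-- For a fixed antitone `w ∈ d_p`, the uniform boundedness principle on `ℓ^∞` bounds the weighted
convolutions of `w` with `|c|`, whenever `c` is a multiplier. -/
lemma IsMultiplier.exists_forall_mul_rpow_le {p : ℝ} (hp : 0 < p) {c : ℕ → ℂ}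
    (hc : IsMultiplier p c) {w : ℕ → ℝ} (hw : Antitone w) (hw0 : ∀ n, 0 ≤ w n)
    (hws : Summable fun n => w n ^ p) :
    ∃ B : ℝ, ∀ k : ℕ,
      ((k : ℝ) + 1) * (∑ j ∈ Finset.range (k + 1), w j * ‖c (k - j)‖) ^ p ≤ B := by
  set g : ℕ → (BoundedContinuousFunction ℕ ℂ →L[ℂ] ℂ) := fun k =>
    ∑ j ∈ Finset.range (k + 1),
      ((((k : ℝ) + 1) ^ p⁻¹ * w j : ℝ) * c (k - j)) • BoundedContinuousFunction.evalCLM ℂ j with hg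
  have hgapp : ∀ k x, g k x = ((((k : ℝ) + 1) ^ p⁻¹ : ℝ) : ℂ) * conv (fun j => x j * w j) c k := by
    intro k x
    simp only [hg, conv, sum_apply, smul_apply,
      BoundedContinuousFunction.evalCLM_apply, smul_eq_mul, Finset.mul_sum]
    refine Finset.sum_congr rfl fun j _ => ?_
    push_cast
    ring
  have hk0 : ∀ k : ℕ, (0 : ℝ) ≤ (k : ℝ) + 1 := fun k => by positivity
  have hpt : ∀ x, ∃ C, ∀ k, ‖g k x‖ ≤ C := by
    intro x
    have hmem : MemDp p (fun j => x j * w j) := by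
      refine memDp_of_forall_norm_le hp (u := fun n => ‖x‖ * w n)
        (fun n => mul_nonneg (norm_nonneg _) (hw0 n)) ?_ fun n k hnk => ?_
      · refine (hws.mul_left (‖x‖ ^ p)).congr fun n => ?_
        rw [Real.mul_rpow (norm_nonneg _) (hw0 n)]
      · rw [norm_mul, Complex.norm_real, Real.norm_of_nonneg (hw0 k)]
        exact mul_le_mul (x.norm_coe_le_norm k) (hw hnk) (hw0 k) (norm_nonneg _)
    obtain ⟨u, hu, hu0, hus, hcu⟩ := (hc _ hmem).exists_antitone_majorant hp
    refine ⟨(∑' n, u n ^ p) ^ p⁻¹, fun k => ?_⟩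
    rw [hgapp, norm_mul, Complex.norm_real, Real.norm_of_nonneg (Real.rpow_nonneg (hk0 k) _)]
    have h1 : ((k : ℝ) + 1) * u k ^ p ≤ ∑' n, u n ^ p := by
      refine le_trans ?_ (hus.sum_le_tsum (Finset.range (k + 1))
        fun i _ => Real.rpow_nonneg (hu0 i) p)
      have h : ∑ _j ∈ Finset.range (k + 1), u k ^ p ≤ ∑ j ∈ Finset.range (k + 1), u j ^ p :=
        Finset.sum_le_sum fun j hj => Real.rpow_le_rpow (hu0 k)
          (hu (Nat.lt_succ_iff.1 (Finset.mem_range.1 hj))) hp.le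
      simpa using h
    have hT : 0 ≤ ∑' n, u n ^ p := tsum_nonneg fun n => Real.rpow_nonneg (hu0 n) p
    calc _ ≤ ((k : ℝ) + 1) ^ p⁻¹ * u k :=
          mul_le_mul_of_nonneg_left (hcu k) (Real.rpow_nonneg (hk0 k) _)
      _ ≤ _ := by
          rw [Real.le_rpow_inv_iff_of_pos (mul_nonneg (Real.rpow_nonneg (hk0 k) _) (hu0 k)) hT hp,
            Real.mul_rpow (Real.rpow_nonneg (hk0 k) _) (hu0 k), ← Real.rpow_mul (hk0 k),
            inv_mul_cancel₀ hp.ne', Real.rpow_one]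
          exact h1
  obtain ⟨C, hC⟩ := banach_steinhaus hpt
  refine ⟨C ^ p, fun k => ?_⟩
  set s : ℕ → ℂ := fun j => (starRingEnd ℂ) (c (k - j)) / ‖c (k - j)‖ with hs
  have hs1 : ∀ j, ‖s j‖ ≤ 1 := fun j => by
    simp only [hs, norm_div, RCLike.norm_conj, Complex.norm_real, norm_norm]
    exact div_self_le_one _
  set x : BoundedContinuousFunction ℕ ℂ :=
    BoundedContinuousFunction.ofNormedAddCommGroupDiscrete s 1 hs1 with hx
  have hxn : ‖x‖ ≤ 1 := (BoundedContinuousFunction.norm_le zero_le_one).2 hs1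
  have hconv : conv (fun j => x j * w j) c k
      = ((∑ j ∈ Finset.range (k + 1), w j * ‖c (k - j)‖ : ℝ) : ℂ) := by
    simp only [conv, Complex.ofReal_sum]
    refine Finset.sum_congr rfl fun j _ => ?_
    have hxj : x j = s j := rfl
    have hsc : s j * c (k - j) = ‖c (k - j)‖ := by
      simp only [hs]
      rcases eq_or_ne (c (k - j)) 0 with h | h
      · simp [h]
      · have h' : (‖c (k - j)‖ : ℂ) ≠ 0 := by exact_mod_cast norm_ne_zero_iff.2 h
        rw [div_mul_eq_mul_div, Complex.conj_mul', div_eq_iff h', sq]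
    rw [hxj, mul_right_comm, hsc]
    push_cast
    ring
  have hS : 0 ≤ ∑ j ∈ Finset.range (k + 1), w j * ‖c (k - j)‖ :=
    Finset.sum_nonneg fun j _ => mul_nonneg (hw0 j) (norm_nonneg _)
  have h1 : ((k : ℝ) + 1) ^ p⁻¹ * ∑ j ∈ Finset.range (k + 1), w j * ‖c (k - j)‖ ≤ C := by
    have h2 : ‖g k x‖ ≤ C := (g k).le_of_opNorm_le_of_le (hC k) hxn |>.trans_eq (mul_one C)
    rwa [hgapp, hconv, norm_mul, Complex.norm_real, Complex.norm_real,
      Real.norm_of_nonneg (Real.rpow_nonneg (hk0 k) _), Real.norm_of_nonneg hS] at h2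
  have h3 := Real.rpow_le_rpow (mul_nonneg (Real.rpow_nonneg (hk0 k) _) hS) h1 hp.le
  rwa [Real.mul_rpow (Real.rpow_nonneg (hk0 k) _) hS, ← Real.rpow_mul (hk0 k),
    inv_mul_cancel₀ hp.ne', Real.rpow_one] at h3

/-- Every multiplier of `d_p` satisfies the weak convolution bound, by a gliding hump argument. -/
lemma IsMultiplier.hasWeakConvBound {p : ℝ} (hp : 0 < p) {c : ℕ → ℂ} (hc : IsMultiplier p c) :
    HasWeakConvBound p c := by
  by_contra hcon
  have hex : ∀ i : ℕ, ∃ w : ℕ → ℝ, Antitone w ∧ (∀ n, 0 ≤ w n) ∧ ∃ k : ℕ,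
      (4 : ℝ) ^ i * ∑ j ∈ Finset.range (k + 1), w j ^ p
        < ((k : ℝ) + 1) * (∑ j ∈ Finset.range (k + 1), w j * ‖c (k - j)‖) ^ p := by
    intro i
    by_contra h
    push Not at h
    exact hcon ⟨4 ^ i, by positivity, h⟩
  choose w hwa hw0 k hk using hex
  set S : ℕ → ℝ := fun i => ∑ j ∈ Finset.range (k i + 1), w i j ^ p with hS
  have hS0 : ∀ i, 0 ≤ S i := fun i => Finset.sum_nonneg fun j _ => Real.rpow_nonneg (hw0 i j) p
  have hSpos : ∀ i, 0 < S i := by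
    intro i
    refine (hS0 i).lt_of_ne' fun h => ?_
    have h1 : ∀ j ∈ Finset.range (k i + 1), w i j = 0 := fun j hj =>
      (Real.rpow_eq_zero (hw0 i j) hp.ne').1
        ((Finset.sum_eq_zero_iff_of_nonneg fun j _ => Real.rpow_nonneg (hw0 i j) p).1 h j hj)
    have h2 : ∑ j ∈ Finset.range (k i + 1), w i j * ‖c (k i - j)‖ = 0 :=
      Finset.sum_eq_zero fun j hj => by rw [h1 j hj, zero_mul]
    have h3 := hk i
    rw [h2, Real.zero_rpow hp.ne', mul_zero] at h3
    exact absurd h3 (not_lt.2 (mul_nonneg (by positivity) (hS0 i)))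
  set t : ℕ → ℝ := fun i => (1 / 2 : ℝ) ^ i / S i with ht
  have ht0 : ∀ i, 0 ≤ t i := fun i => div_nonneg (by positivity) (hS0 i)
  set F : ℕ → ℕ → ℝ := fun i j => if j ≤ k i then w i j ^ p * t i else 0 with hF
  have hF0 : ∀ i j, 0 ≤ F i j := fun i j => by
    simp only [hF]
    split_ifs
    · exact mul_nonneg (Real.rpow_nonneg (hw0 i j) p) (ht0 i)
    · exact le_rfl
  have hFanti : ∀ i, Antitone (F i) := by
    intro i j l hjl
    simp only [hF]
    split_ifs with h1 h2
    · exact mul_le_mul_of_nonneg_right (Real.rpow_le_rpow (hw0 i l) (hwa i hjl) hp.le) (ht0 i)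
    · omega
    · exact mul_nonneg (Real.rpow_nonneg (hw0 i j) p) (ht0 i)
    · exact le_rfl
  have hFsum : ∀ i, HasSum (F i) ((1 / 2 : ℝ) ^ i) := by
    intro i
    have h1 : HasSum (F i) (∑ j ∈ Finset.range (k i + 1), F i j) :=
      hasSum_sum_of_ne_finset_zero fun j hj => by
        have : ¬ j ≤ k i := fun h => hj (Finset.mem_range.2 (Nat.lt_succ_iff.2 h))
        simp [hF, this]
    have h2 : ∑ j ∈ Finset.range (k i + 1), F i j = (1 / 2 : ℝ) ^ i := by
      calc _ = ∑ j ∈ Finset.range (k i + 1), w i j ^ p * t i :=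
            Finset.sum_congr rfl fun j hj => by
              have : j ≤ k i := Nat.lt_succ_iff.1 (Finset.mem_range.1 hj)
              simp [hF, this]
        _ = S i * t i := by rw [Finset.sum_mul]
        _ = _ := mul_div_cancel₀ _ (hSpos i).ne'
    rwa [h2] at h1
  have hFall : Summable fun x : ℕ × ℕ => F x.1 x.2 := by
    rw [summable_prod_of_nonneg fun x => hF0 x.1 x.2]
    refine ⟨fun i => (hFsum i).summable, ?_⟩
    simp only [(hFsum _).tsum_eq]
    exact summable_geometric_two
  have hFswap : Summable fun x : ℕ × ℕ => F x.2 x.1 := hFall.prod_symm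
  have hFcol : ∀ j, Summable fun i => F i j := fun j => hFswap.prod_factor j
  have hG0 : ∀ j, 0 ≤ ∑' i, F i j := fun j => tsum_nonneg fun i => hF0 i j
  set W : ℕ → ℝ := fun j => (∑' i, F i j) ^ p⁻¹ with hW
  have hW0 : ∀ j, 0 ≤ W j := fun j => Real.rpow_nonneg (hG0 j) _
  have hWanti : Antitone W := fun j l hjl =>
    Real.rpow_le_rpow (hG0 l)
      ((hFcol l).tsum_le_tsum (fun i => hFanti i hjl) (hFcol j)) (by positivity)
  have hWs : Summable fun j => W j ^ p := by
    refine hFswap.prod.congr fun j => ?_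
    rw [← Real.rpow_mul (hG0 j), inv_mul_cancel₀ hp.ne', Real.rpow_one]
  obtain ⟨B, hB⟩ := hc.exists_forall_mul_rpow_le hp hWanti hW0 hWs
  obtain ⟨i, hi⟩ := pow_unbounded_of_one_lt B one_lt_two
  have hX0 : 0 ≤ ∑ j ∈ Finset.range (k i + 1), w i j * ‖c (k i - j)‖ :=
    Finset.sum_nonneg fun j _ => mul_nonneg (hw0 i j) (norm_nonneg _)
  have hle : t i ^ p⁻¹ * ∑ j ∈ Finset.range (k i + 1), w i j * ‖c (k i - j)‖
      ≤ ∑ j ∈ Finset.range (k i + 1), W j * ‖c (k i - j)‖ := by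
    rw [Finset.mul_sum]
    refine Finset.sum_le_sum fun j hj => ?_
    rw [← mul_assoc]
    refine mul_le_mul_of_nonneg_right ?_ (norm_nonneg _)
    have hjk : j ≤ k i := Nat.lt_succ_iff.1 (Finset.mem_range.1 hj)
    calc t i ^ p⁻¹ * w i j = (F i j) ^ p⁻¹ := by
          simp only [hF, if_pos hjk]
          rw [Real.mul_rpow (Real.rpow_nonneg (hw0 i j) p) (ht0 i), ← Real.rpow_mul (hw0 i j),
            mul_inv_cancel₀ hp.ne', Real.rpow_one, mul_comm]
      _ ≤ W j := Real.rpow_le_rpow (hF0 i j)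
          ((hFcol j).le_tsum i fun l _ => hF0 l j) (by positivity)
  have hpow := Real.rpow_le_rpow (mul_nonneg (Real.rpow_nonneg (ht0 i) _) hX0) hle hp.le
  rw [Real.mul_rpow (Real.rpow_nonneg (ht0 i) _) hX0, ← Real.rpow_mul (ht0 i),
    inv_mul_cancel₀ hp.ne', Real.rpow_one] at hpow
  have h1 := mul_le_mul_of_nonneg_left (hk i).le (ht0 i)
  have h2 : t i * ((4 : ℝ) ^ i * ∑ j ∈ Finset.range (k i + 1), w i j ^ p) = 2 ^ i := by
    change (1 / 2 : ℝ) ^ i / S i * (4 ^ i * S i) = 2 ^ i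
    have := (hSpos i).ne'
    rw [div_mul_eq_mul_div, div_eq_iff this, ← mul_assoc, ← mul_pow]
    norm_num
  have h3 := mul_le_mul_of_nonneg_left hpow (show (0 : ℝ) ≤ (k i : ℝ) + 1 by positivity)
  linarith [hB (k i)]

lemma add_rpow_le_two_rpow_mul {p x y : ℝ} (hp : 0 ≤ p) (hx : 0 ≤ x) (hy : 0 ≤ y) :
    (x + y) ^ p ≤ 2 ^ p * (x ^ p + y ^ p) := by
  have h : (x + y) ^ p ≤ (2 * max x y) ^ p :=
    Real.rpow_le_rpow (by positivity) (by linarith [le_max_left x y, le_max_right x y]) hp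
  rw [Real.mul_rpow zero_le_two (hx.trans (le_max_left x y))] at h
  refine h.trans (mul_le_mul_of_nonneg_left ?_ (by positivity))
  have h1 := Real.rpow_nonneg hx p
  have h2 := Real.rpow_nonneg hy p
  rcases max_choice x y with h | h <;> rw [h] <;> linarith

/-- The lacunary sequence with `b_{2^k} = 2^{-k/p}` satisfies the weak convolution bound at `p`. -/
lemma hasWeakConvBound_of_lacunary {p : ℝ} (hp : 0 < p) {b : ℕ → ℂ}
    (hb : ∀ k : ℕ, b (2 ^ k) = (((2 : ℝ) ^ (-(k : ℝ) / p) : ℝ) : ℂ))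
    (hb0 : ∀ n : ℕ, (∀ k : ℕ, n ≠ 2 ^ k) → b n = 0) : HasWeakConvBound p b := by
  have hnorm : ∀ i : ℕ, ‖b (2 ^ i)‖ = (2 : ℝ) ^ (-(i : ℝ) / p) := fun i => by
    rw [hb, Complex.norm_real, Real.norm_of_nonneg (by positivity)]
  have hmul : ∀ i : ℕ, (2 : ℝ) ^ i * ‖b (2 ^ i)‖ ^ p = 1 := fun i => by
    rw [hnorm, ← Real.rpow_mul zero_le_two, div_mul_cancel₀ _ hp.ne', Real.rpow_neg zero_le_two,
      Real.rpow_natCast, mul_inv_cancel₀ (by positivity)]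
  have hsum : Summable fun m => ‖b m‖ := by
    rw [← (Nat.pow_right_injective (le_refl 2)).summable_iff]
    · have hgeo : Summable fun i : ℕ => ((2 : ℝ) ^ (-1 / p)) ^ i :=
        summable_geometric_of_lt_one (by positivity)
          (Real.rpow_lt_one_of_one_lt_of_neg one_lt_two (div_neg_of_neg_of_pos (by norm_num) hp))
      refine hgeo.congr fun i => ?_
      rw [Function.comp_apply, hnorm, ← Real.rpow_natCast, ← Real.rpow_mul zero_le_two]
      congr 1
      ring
    · intro m hm
      rw [hb0 m fun i hi => hm ⟨i, hi.symm⟩, norm_zero]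
  set B : ℝ := ∑' m, ‖b m‖ with hB
  have hB0 : 0 ≤ B := tsum_nonneg fun m => norm_nonneg _
  refine ⟨2 ^ p * (2 * B ^ p + 2), by positivity, fun w hw hw0 k => ?_⟩
  set L : ℝ := ∑ j ∈ Finset.range (k + 1), w j ^ p with hL
  have hwp : ∀ j, 0 ≤ w j ^ p := fun j => Real.rpow_nonneg (hw0 j) p
  set T : ℝ := ∑ m ∈ Finset.range (k + 1), if k < 2 * m then ‖b m‖ else 0 with hT
  have hT0 : 0 ≤ T := Finset.sum_nonneg fun m _ => by split_ifs <;> positivity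
  have hTp : ((k : ℝ) + 1) * T ^ p ≤ 2 := by
    by_cases hex : ∃ i : ℕ, 2 ^ i ≤ k ∧ k < 2 * 2 ^ i
    · obtain ⟨i, hi1, hi2⟩ := hex
      have hTi : T = ‖b (2 ^ i)‖ := by
        rw [hT, Finset.sum_eq_single (2 ^ i)]
        · rw [if_pos hi2]
        · intro m hm hmi
          split_ifs with hkm
          · rw [hb0 m, norm_zero]
            rintro l rfl
            have hlk : 2 ^ l ≤ k := Nat.lt_succ_iff.1 (Finset.mem_range.1 hm)
            have h1 : 2 ^ l < 2 ^ (i + 1) := by rw [pow_succ]; omega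
            have h2 : 2 ^ i < 2 ^ (l + 1) := by rw [pow_succ]; omega
            have h3 := (Nat.pow_lt_pow_iff_right (le_refl 2)).1 h1
            have h4 := (Nat.pow_lt_pow_iff_right (le_refl 2)).1 h2
            exact hmi (by rw [show l = i by omega])
          · rfl
        · intro h
          exact absurd (Finset.mem_range.2 (Nat.lt_succ_iff.2 hi1)) h
      have hk2 : (k : ℝ) + 1 ≤ 2 * 2 ^ i := by exact_mod_cast hi2
      calc ((k : ℝ) + 1) * T ^ p ≤ 2 * 2 ^ i * T ^ p :=
            mul_le_mul_of_nonneg_right hk2 (Real.rpow_nonneg hT0 p)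
        _ = 2 := by rw [hTi, mul_assoc, hmul, mul_one]
    · have hTz : T = 0 := by
        refine Finset.sum_eq_zero fun m hm => ?_
        split_ifs with hkm
        · rw [hb0 m, norm_zero]
          rintro l rfl
          exact hex ⟨l, Nat.lt_succ_iff.1 (Finset.mem_range.1 hm), hkm⟩
        · rfl
      rw [hTz, Real.zero_rpow hp.ne', mul_zero]
      exact zero_le_two
  have hwhalf : ((k : ℝ) + 1) * w (k / 2) ^ p ≤ 2 * L := by
    have h1 : ∑ _j ∈ Finset.range (k / 2 + 1), w (k / 2) ^ p ≤ L :=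
      (Finset.sum_le_sum fun j hj => Real.rpow_le_rpow (hw0 _)
        (hw (Nat.lt_succ_iff.1 (Finset.mem_range.1 hj))) hp.le).trans
        (Finset.sum_le_sum_of_subset_of_nonneg
          (Finset.range_mono (Nat.succ_le_succ (Nat.div_le_self k 2))) fun j _ _ => hwp j)
    rw [Finset.sum_const, Finset.card_range, nsmul_eq_mul] at h1
    have h2 : (k : ℝ) + 1 ≤ 2 * ((k / 2 + 1 : ℕ) : ℝ) := by
      have : k + 1 ≤ 2 * (k / 2 + 1) := by omega
      exact_mod_cast this
    nlinarith [mul_le_mul_of_nonneg_right h2 (hwp (k / 2))]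
  have hwzero : w 0 ^ p ≤ L :=
    Finset.single_le_sum (f := fun j => w j ^ p) (fun j _ => hwp j)
      (Finset.mem_range.2 (Nat.succ_pos k))
  have hX : ∑ j ∈ Finset.range (k + 1), w j * ‖b (k - j)‖ ≤ w (k / 2) * B + w 0 * T := by
    have hreflect : ∑ j ∈ Finset.range (k + 1), w j * ‖b (k - j)‖
        = ∑ m ∈ Finset.range (k + 1), w (k - m) * ‖b m‖ := by
      rw [← Finset.sum_range_reflect]
      refine Finset.sum_congr rfl fun j hj => ?_
      have : j ≤ k := Nat.lt_succ_iff.1 (Finset.mem_range.1 hj)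
      rw [Nat.add_sub_cancel, Nat.sub_sub_self this]
    have hBsum : ∑ m ∈ Finset.range (k + 1), ‖b m‖ ≤ B :=
      hsum.sum_le_tsum _ fun m _ => norm_nonneg _
    calc _ = ∑ m ∈ Finset.range (k + 1), w (k - m) * ‖b m‖ := hreflect
      _ ≤ ∑ m ∈ Finset.range (k + 1),
          (w (k / 2) * ‖b m‖ + w 0 * if k < 2 * m then ‖b m‖ else 0) := by
          refine Finset.sum_le_sum fun m _ => ?_
          have h0 : 0 ≤ w (k / 2) * ‖b m‖ := mul_nonneg (hw0 _) (norm_nonneg _)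
          split_ifs with h
          · linarith [mul_le_mul_of_nonneg_right (hw (Nat.zero_le (k - m))) (norm_nonneg (b m))]
          · rw [mul_zero, add_zero]
            exact mul_le_mul_of_nonneg_right (hw (by omega)) (norm_nonneg _)
      _ = w (k / 2) * ∑ m ∈ Finset.range (k + 1), ‖b m‖ + w 0 * T := by
          rw [Finset.sum_add_distrib, Finset.mul_sum, Finset.mul_sum]
      _ ≤ _ := by
          have := mul_le_mul_of_nonneg_left hBsum (hw0 (k / 2))
          linarith
  have hX0 : 0 ≤ ∑ j ∈ Finset.range (k + 1), w j * ‖b (k - j)‖ :=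
    Finset.sum_nonneg fun j _ => mul_nonneg (hw0 j) (norm_nonneg _)
  have hXp := (Real.rpow_le_rpow hX0 hX hp.le).trans (add_rpow_le_two_rpow_mul hp.le
    (mul_nonneg (hw0 (k / 2)) hB0) (mul_nonneg (hw0 0) hT0))
  rw [Real.mul_rpow (hw0 _) hB0, Real.mul_rpow (hw0 _) hT0] at hXp
  calc _ ≤ ((k : ℝ) + 1) * (2 ^ p * (w (k / 2) ^ p * B ^ p + w 0 ^ p * T ^ p)) := by gcongr
    _ = 2 ^ p * (((k : ℝ) + 1) * w (k / 2) ^ p * B ^ p + w 0 ^ p * (((k : ℝ) + 1) * T ^ p)) := by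
        ring
    _ ≤ 2 ^ p * (2 * L * B ^ p + L * 2) := by
        have hTp0 : 0 ≤ ((k : ℝ) + 1) * T ^ p := by positivity
        have hL0 : 0 ≤ L := (hwp 0).trans hwzero
        gcongr
    _ = _ := by ring

lemma not_memDp_of_lacunary {p : ℝ} (hp : 0 < p) {b : ℕ → ℂ}
    (hb : ∀ k : ℕ, b (2 ^ k) = (((2 : ℝ) ^ (-(k : ℝ) / p) : ℝ) : ℂ)) : ¬ MemDp p b := by
  intro h
  obtain ⟨w, hw, hw0, hws, hbw⟩ := h.exists_antitone_majorant hp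
  rw [← summable_condensed_iff_of_nonneg (fun n => Real.rpow_nonneg (hw0 n) p)
    fun m n _ hmn => Real.rpow_le_rpow (hw0 n) (hw hmn) hp.le] at hws
  have hge : ∀ k : ℕ, 1 ≤ (2 : ℝ) ^ k * w (2 ^ k) ^ p := by
    intro k
    have h1 := Real.rpow_le_rpow (norm_nonneg _) (hbw (2 ^ k)) hp.le
    rw [hb, Complex.norm_real, Real.norm_of_nonneg (by positivity), ← Real.rpow_mul zero_le_two,
      div_mul_cancel₀ _ hp.ne', Real.rpow_neg zero_le_two, Real.rpow_natCast] at h1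
    calc (1 : ℝ) = 2 ^ k * (2 ^ k)⁻¹ := (mul_inv_cancel₀ (by positivity)).symm
      _ ≤ _ := mul_le_mul_of_nonneg_left h1 (by positivity)
  exact absurd (ge_of_tendsto' hws.tendsto_atTop_zero hge) (by norm_num)

lemma conv_e_zero (b : ℕ → ℂ) : conv (e 0) b = b := by
  funext n
  simp [conv, e]

lemma memDp_e_zero {p : ℝ} (hp : 0 < p) : MemDp p (e 0) := by
  refine memDp_of_forall_norm_le hp (u := fun n => if n = 0 then 1 else 0)
    (fun n => by split_ifs <;> norm_num) ?_ fun n k hnk => ?_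
  · refine summable_of_ne_finset_zero (s := {0}) fun n hn => ?_
    rw [Finset.mem_singleton] at hn
    simp [hn, Real.zero_rpow hp.ne']
  · by_cases hk : k = 0
    · have hn : n = 0 := by omega
      simp [e, hk, hn]
    · simp only [e, if_neg hk, norm_zero]
      split_ifs <;> norm_num

/-- for `1 ≤ p₁ < p₂ < ∞`, every multiplier of `d_{p₁}` is a multiplier of
`d_{p₂}`, while the sequence `b` with `b_{2^k} = 2^{-k/p₁}` and `b_n = 0` otherwise is a
multiplier of `d_{p₂}` that does not lie in `d_{p₁}` (hence is not a multiplier of `d_{p₁}`).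
Thus `M(d_{p₁}) ⊊ M(d_{p₂})`. -/
theorem multipliers_strictly_monotone (p₁ p₂ : ℝ) (hp₁ : 1 ≤ p₁) (hp : p₁ < p₂)
    (b : ℕ → ℂ)
    (hb : ∀ k : ℕ, b (2 ^ k) = (((2 : ℝ) ^ (-(k : ℝ) / p₁) : ℝ) : ℂ))
    (hb0 : ∀ n : ℕ, (∀ k : ℕ, n ≠ 2 ^ k) → b n = 0) :
    (∀ c : ℕ → ℂ, IsMultiplier p₁ c → IsMultiplier p₂ c) ∧
    IsMultiplier p₂ b ∧ ¬ MemDp p₁ b ∧ ¬ IsMultiplier p₁ b := by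
  have h₁ : 0 < p₁ := by linarith
  have hnot := not_memDp_of_lacunary h₁ hb
  refine ⟨fun c hc => (hc.hasWeakConvBound h₁).isMultiplier h₁ hp,
    (hasWeakConvBound_of_lacunary h₁ hb hb0).isMultiplier h₁ hp, hnot, fun hm => hnot ?_⟩
  have h := hm (e 0) (memDp_e_zero h₁)
  rwa [conv_e_zero] at h
end

section
/- Let 1 ≤ p < ∞. There exists a constant K > 0 (depending only on p) such that: whenever b ∈ ℓ¹ satisfies ∑_{n=0}^∞ 2^{np} · sup_{2ⁿ ≤ k < 2^{n+1}} |b_k|^p < ∞, the sequence b is a multiplier of d_p, and for all a ∈ d_p one has ‖b*a‖_{d_p} ≤ K · max{ ∑_{j}|b_j|, (sup_{k≥0}|b_k|^p + ∑_{n=0}^∞ 2^{np} sup_{2ⁿ≤k<2^{n+1}}|b_k|^p)^{1/p} } · ‖a‖_{d_p}. -/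
open scoped ENNReal NNReal BigOperators

/-- The sum `∑_n 2^{np} sup_{2ⁿ ≤ k < 2^{n+1}} |b_k|^p` defining membership in `d_{pp}`. -/
noncomputable def dppSum (p : ℝ) (b : ℕ → ℂ) : ℝ≥0∞ :=
  ∑' n : ℕ, (2 : ℝ≥0∞) ^ ((n : ℝ) * p) *
    ⨆ k ∈ Set.Ico (2 ^ n) (2 ^ (n + 1)), (‖b k‖₊ : ℝ≥0∞) ^ p

/-- The `d_{pp}` norm `(sup_k |b_k|^p + ∑_n 2^{np} sup_{2ⁿ ≤ k < 2^{n+1}} |b_k|^p)^{1/p}`. -/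
noncomputable def dppNorm (p : ℝ) (b : ℕ → ℂ) : ℝ≥0∞ :=
  ((⨆ k : ℕ, (‖b k‖₊ : ℝ≥0∞) ^ p) + dppSum p b) ^ (1 / p)

lemma conv_comm (a b : ℕ → ℂ) : conv a b = conv b a := by
  funext n
  unfold conv
  rw [← Finset.sum_range_reflect]
  refine Finset.sum_congr rfl fun j hj => ?_
  have hj' : j ≤ n := by simpa [Nat.lt_succ_iff] using hj
  rw [show n + 1 - 1 - j = n - j by omega, Nat.sub_sub_self hj', mul_comm]

/-- `⨆_{k ≥ n} |a_k|^p`, the `n`-th term of `dpSum p a`. -/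
noncomputable def tailSup (p : ℝ) (a : ℕ → ℂ) (n : ℕ) : ℝ≥0∞ :=
  ⨆ k ∈ Set.Ici n, (‖a k‖₊ : ℝ≥0∞) ^ p

/-- `⨆_{2ⁿ ≤ k < 2ⁿ⁺¹} |b_k|^p`, the dyadic block suprema in `dppSum p b`. -/
noncomputable def blockSup (p : ℝ) (b : ℕ → ℂ) (n : ℕ) : ℝ≥0∞ :=
  ⨆ k ∈ Set.Ico (2 ^ n) (2 ^ (n + 1)), (‖b k‖₊ : ℝ≥0∞) ^ p

lemma le_tailSup (p : ℝ) (a : ℕ → ℂ) {n k : ℕ} (h : n ≤ k) :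
    (‖a k‖₊ : ℝ≥0∞) ^ p ≤ tailSup p a n :=
  le_iSup₂ (f := fun k (_ : k ∈ Set.Ici n) => (‖a k‖₊ : ℝ≥0∞) ^ p) k h

lemma tailSup_antitone (p : ℝ) (a : ℕ → ℂ) : Antitone (tailSup p a) := fun _ _ h =>
  iSup₂_le fun _ hk => le_tailSup p a (h.trans hk)

lemma le_blockSup_log (p : ℝ) (b : ℕ → ℂ) {k : ℕ} (h : k ≠ 0) :
    (‖b k‖₊ : ℝ≥0∞) ^ p ≤ blockSup p b (Nat.log 2 k) :=
  le_iSup₂ (f := fun k (_ : k ∈ Set.Ico (2 ^ _) (2 ^ (_ + 1))) => (‖b k‖₊ : ℝ≥0∞) ^ p) k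
    ⟨Nat.pow_log_le_self 2 h, Nat.lt_pow_succ_log_self one_lt_two k⟩

lemma tsum_comp_half (f : ℕ → ℝ≥0∞) : ∑' k, f (k / 2) = 2 * ∑' k, f k := by
  have heven (k : ℕ) : f (2 * k / 2) = f k := congrArg f (by omega)
  have hodd (k : ℕ) : f ((2 * k + 1) / 2) = f k := congrArg f (by omega)
  rw [← tsum_even_add_odd (f := fun k => f (k / 2)) ENNReal.summable ENNReal.summable]
  simp only [heven, hodd, two_mul (∑' k, f k)]

lemma tsum_tsum_log_le (D : ℕ → ℝ≥0∞) :
    ∑' k : ℕ, ∑' n : ℕ, (if Nat.log 2 k ≤ n then D n else 0) = ∑' n : ℕ, 2 ^ (n + 1) * D n := by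
  rw [ENNReal.tsum_comm]
  refine tsum_congr fun n => ?_
  have hlog (k : ℕ) : Nat.log 2 k ≤ n ↔ k ∈ Finset.range (2 ^ (n + 1)) := by
    rw [Finset.mem_range, ← Nat.lt_succ_iff]
    exact ⟨Nat.lt_pow_of_log_lt one_lt_two, Nat.log_lt_of_lt_pow' n.succ_ne_zero⟩
  rw [tsum_eq_sum (s := Finset.range (2 ^ (n + 1))) fun k hk => if_neg fun h => hk ((hlog k).1 h),
    Finset.sum_congr rfl fun k hk => if_pos ((hlog k).2 hk)]
  simp

lemma tsum_block_shift_le (p : ℝ) (f : ℕ → ℝ≥0∞) :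
    ∑' n : ℕ, (2 : ℝ≥0∞) ^ ((n : ℝ) * p) * (f n + f (n - 1)) ≤
      (2 + 2 ^ p) * ∑' n : ℕ, (2 : ℝ≥0∞) ^ ((n : ℝ) * p) * f n := by
  set W := ∑' n : ℕ, (2 : ℝ≥0∞) ^ ((n : ℝ) * p) * f n with hW
  have h0 : f 0 ≤ W := by
    simpa using ENNReal.le_tsum (f := fun n : ℕ => (2 : ℝ≥0∞) ^ ((n : ℝ) * p) * f n) 0
  have hshift : ∑' n : ℕ, (2 : ℝ≥0∞) ^ ((n : ℝ) * p) * f (n - 1) = f 0 + 2 ^ p * W := by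
    rw [tsum_eq_zero_add' ENNReal.summable, hW, ← ENNReal.tsum_mul_left]
    congr 1
    · simp
    · refine tsum_congr fun n => ?_
      rw [Nat.add_sub_cancel, ← mul_assoc, ← ENNReal.rpow_add _ _ two_ne_zero ENNReal.ofNat_ne_top]
      congr 2
      push_cast
      ring
  simp_rw [mul_add]
  rw [ENNReal.tsum_add, hshift, ← hW]
  calc W + (f 0 + 2 ^ p * W) ≤ W + (W + 2 ^ p * W) := by gcongr
    _ = (2 + 2 ^ p) * W := by ring

/-- The part of the convolution where the index of `a` is at least half of the total index. -/
lemma sum_upper_half_rpow_le {p : ℝ} (hp : 1 ≤ p) (a b : ℕ → ℂ) (m : ℕ) :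
    (∑ j ∈ Finset.range (m + 1) with ¬ 2 * j < m, (‖a j‖₊ : ℝ≥0∞) * ‖b (m - j)‖₊) ^ p ≤
      tailSup p a (m / 2) * (∑' n, (‖b n‖₊ : ℝ≥0∞)) ^ p := by
  have hp0 : 0 < p := by linarith
  have ha : ∀ j, ¬ 2 * j < m → (‖a j‖₊ : ℝ≥0∞) ≤ tailSup p a (m / 2) ^ p⁻¹ := fun j hj =>
    (ENNReal.le_rpow_inv_iff hp0).2 (le_tailSup p a (by omega))
  have hb : ∑ j ∈ Finset.range (m + 1), (‖b (m - j)‖₊ : ℝ≥0∞) ≤ ∑' n, (‖b n‖₊ : ℝ≥0∞) := by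
    have := Finset.sum_range_reflect (fun j => (‖b j‖₊ : ℝ≥0∞)) (m + 1)
    simp only [Nat.add_sub_cancel] at this
    rw [this]
    exact ENNReal.sum_le_tsum _
  calc _ ≤ (∑ j ∈ Finset.range (m + 1) with ¬ 2 * j < m,
          tailSup p a (m / 2) ^ p⁻¹ * (‖b (m - j)‖₊ : ℝ≥0∞)) ^ p := by
        gcongr with j hj
        exact ha j (Finset.mem_filter.1 hj).2
    _ ≤ (tailSup p a (m / 2) ^ p⁻¹ * ∑' n, (‖b n‖₊ : ℝ≥0∞)) ^ p := by
        rw [← Finset.mul_sum]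
        gcongr
        exact (Finset.sum_le_sum_of_subset (Finset.filter_subset _ _)).trans hb
    _ = _ := by
        rw [ENNReal.mul_rpow_of_nonneg _ _ hp0.le, ENNReal.rpow_inv_rpow hp0.ne']

/-- The part of the convolution where the index of `b` is more than half of the total index. -/
lemma sum_lower_half_rpow_le {p : ℝ} (hp : 1 ≤ p) (a b : ℕ → ℂ) (m : ℕ) :
    (∑ j ∈ Finset.range (m + 1) with 2 * j < m, (‖a j‖₊ : ℝ≥0∞) * ‖b (m - j)‖₊) ^ p ≤
      ((2 : ℝ≥0∞) ^ Nat.log 2 m) ^ (p - 1) *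
        ((blockSup p b (Nat.log 2 m) + blockSup p b (Nat.log 2 m - 1)) * dpSum p a) := by
  have hp0 : 0 ≤ p := by linarith
  set s := {j ∈ Finset.range (m + 1) | 2 * j < m} with hs
  have hm : m < 2 ^ (Nat.log 2 m + 1) := Nat.lt_pow_succ_log_self one_lt_two m
  have hcard : (s.card : ℝ≥0∞) ≤ 2 ^ Nat.log 2 m := by
    have : s.card ≤ 2 ^ Nat.log 2 m := by
      refine (Finset.card_le_card (t := Finset.range (2 ^ Nat.log 2 m)) fun j hj => ?_).trans
        (Finset.card_range _).le
      have := (Finset.mem_filter.1 hj).2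
      rw [Finset.mem_range]
      omega
    exact_mod_cast this
  have hb : ∀ j ∈ s, (‖b (m - j)‖₊ : ℝ≥0∞) ^ p ≤
      blockSup p b (Nat.log 2 m) + blockSup p b (Nat.log 2 m - 1) := by
    intro j hj
    have hj := (Finset.mem_filter.1 hj).2
    refine (le_blockSup_log p b (by omega)).trans ?_
    have h1 : Nat.log 2 (m - j) ≤ Nat.log 2 m := Nat.log_mono_right (by omega)
    have h2 : Nat.log 2 m - 1 ≤ Nat.log 2 (m - j) := by
      rw [← Nat.log_div_base]
      exact Nat.log_mono_right (by omega)
    obtain h | h : Nat.log 2 (m - j) = Nat.log 2 m ∨ Nat.log 2 (m - j) = Nat.log 2 m - 1 := by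
      omega
    · rw [h]; exact le_self_add
    · rw [h]; exact le_add_self
  have ha : ∑ j ∈ s, (‖a j‖₊ : ℝ≥0∞) ^ p ≤ dpSum p a :=
    (Finset.sum_le_sum fun j _ => le_tailSup p a le_rfl).trans (ENNReal.sum_le_tsum s)
  calc _ ≤ (s.card : ℝ≥0∞) ^ (p - 1) * ∑ j ∈ s, ((‖a j‖₊ : ℝ≥0∞) * ‖b (m - j)‖₊) ^ p :=
        ENNReal.rpow_sum_le_const_mul_sum_rpow s _ hp
    _ ≤ _ := by
        refine mul_le_mul' (ENNReal.rpow_le_rpow hcard (by linarith)) ?_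
        rw [mul_comm]
        refine le_trans ?_ (mul_le_mul_left ha _)
        rw [Finset.sum_mul]
        refine Finset.sum_le_sum fun j hj => ?_
        rw [ENNReal.mul_rpow_of_nonneg _ _ hp0]
        exact mul_le_mul_right (hb j hj) _

lemma nnnorm_conv_rpow_le {p : ℝ} (hp : 1 ≤ p) (a b : ℕ → ℂ) (m : ℕ) :
    (‖conv a b m‖₊ : ℝ≥0∞) ^ p ≤ 2 ^ (p - 1) *
      (tailSup p a (m / 2) * (∑' n, (‖b n‖₊ : ℝ≥0∞)) ^ p +
        ((2 : ℝ≥0∞) ^ Nat.log 2 m) ^ (p - 1) *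
        ((blockSup p b (Nat.log 2 m) + blockSup p b (Nat.log 2 m - 1)) * dpSum p a)) := by
  have hp0 : 0 ≤ p := by linarith
  have hsum : (‖conv a b m‖₊ : ℝ≥0∞) ≤
      ∑ j ∈ Finset.range (m + 1), (‖a j‖₊ : ℝ≥0∞) * ‖b (m - j)‖₊ := by
    have := nnnorm_sum_le (Finset.range (m + 1)) fun j => a j * b (m - j)
    simp only [nnnorm_mul] at this
    exact_mod_cast this
  rw [← Finset.sum_filter_not_add_sum_filter _ (fun j => 2 * j < m)] at hsum
  refine (ENNReal.rpow_le_rpow hsum hp0).trans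
    ((ENNReal.rpow_add_le_mul_rpow_add_rpow _ _ hp).trans ?_)
  gcongr
  · exact sum_upper_half_rpow_le hp a b m
  · exact sum_lower_half_rpow_le hp a b m

lemma dpSum_conv_le {p : ℝ} (hp : 1 ≤ p) (a b : ℕ → ℂ) :
    dpSum p (conv a b) ≤
      2 ^ p * ((∑' n, (‖b n‖₊ : ℝ≥0∞)) ^ p + (2 + 2 ^ p) * dppSum p b) * dpSum p a := by
  set L := ∑' n, (‖b n‖₊ : ℝ≥0∞)
  set D : ℕ → ℝ≥0∞ := fun n => ((2 : ℝ≥0∞) ^ n) ^ (p - 1) *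
    ((blockSup p b n + blockSup p b (n - 1)) * dpSum p a) with hD
  have hterm (k : ℕ) : tailSup p (conv a b) k ≤ 2 ^ (p - 1) *
      (tailSup p a (k / 2) * L ^ p + ∑' n, if Nat.log 2 k ≤ n then D n else 0) := by
    refine iSup₂_le fun m (hm : k ≤ m) => (nnnorm_conv_rpow_le hp a b m).trans ?_
    gcongr
    · exact tailSup_antitone p a (Nat.div_le_div_right hm)
    · refine le_trans ?_ (ENNReal.le_tsum (Nat.log 2 m))
      rw [if_pos (Nat.log_mono_right hm)]
  have hDsum : ∑' n, 2 ^ (n + 1) * D n ≤ 2 * ((2 + 2 ^ p) * dppSum p b * dpSum p a) := by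
    have hDn (n : ℕ) : 2 ^ (n + 1) * D n = 2 * ((2 : ℝ≥0∞) ^ ((n : ℝ) * p) *
        (blockSup p b n + blockSup p b (n - 1)) * dpSum p a) := by
      have hpow : (2 : ℝ≥0∞) ^ n * ((2 : ℝ≥0∞) ^ n) ^ (p - 1) = 2 ^ ((n : ℝ) * p) := by
        rw [← ENNReal.rpow_natCast, ← ENNReal.rpow_mul,
          ← ENNReal.rpow_add _ _ two_ne_zero ENNReal.ofNat_ne_top]
        congr 1
        ring
      rw [← hpow, hD]
      ring
    simp_rw [hDn]
    rw [ENNReal.tsum_mul_left, ENNReal.tsum_mul_right]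
    gcongr
    exact tsum_block_shift_le p (blockSup p b)
  have htwo : (2 : ℝ≥0∞) ^ p = 2 ^ (p - 1) * 2 := by
    simpa using ENNReal.rpow_add (p - 1) 1 (two_ne_zero' ℝ≥0∞) ENNReal.ofNat_ne_top
  calc dpSum p (conv a b) ≤ ∑' k : ℕ, 2 ^ (p - 1) *
      (tailSup p a (k / 2) * L ^ p + ∑' n, if Nat.log 2 k ≤ n then D n else 0) :=
        ENNReal.tsum_le_tsum hterm
    _ = 2 ^ (p - 1) * (2 * dpSum p a * L ^ p + ∑' n, 2 ^ (n + 1) * D n) := by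
        rw [ENNReal.tsum_mul_left, ENNReal.tsum_add, ENNReal.tsum_mul_right,
          tsum_comp_half (tailSup p a), tsum_tsum_log_le]
        rfl
    _ ≤ 2 ^ (p - 1) * (2 * dpSum p a * L ^ p +
          2 * ((2 + 2 ^ p) * dppSum p b * dpSum p a)) := by gcongr
    _ = 2 ^ (p - 1) * 2 * (L ^ p + (2 + 2 ^ p) * dppSum p b) * dpSum p a := by ring
    _ = _ := by rw [← htwo]

lemma tsum_nnnorm_eq_ofReal {b : ℕ → ℂ} (hb : Summable fun n => ‖b n‖) :
    ∑' n, (‖b n‖₊ : ℝ≥0∞) = ENNReal.ofReal (∑' n, ‖b n‖) := by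
  rw [ENNReal.ofReal_tsum_of_nonneg (fun n => norm_nonneg _) hb]
  exact tsum_congr fun n => (ofReal_norm (b n)).symm

/-- there is `K > 0` such that every `b ∈ d_{pp} ∩ ℓ¹` is a multiplier of `d_p`
with `‖b*a‖_{d_p} ≤ K max(‖b‖_{ℓ¹}, ‖b‖_{d_{pp}}) ‖a‖_{d_p}`. -/
theorem dpp_inter_ellOne_subset_multipliers (p : ℝ) (hp : 1 ≤ p) :
    ∃ K : ℝ, 0 < K ∧ ∀ b : ℕ → ℂ, (Summable fun n : ℕ => ‖b n‖) → dppSum p b ≠ ⊤ →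
      IsMultiplier p b ∧ ∀ a : ℕ → ℂ, MemDp p a →
        dpNorm p (conv b a) ≤
          ENNReal.ofReal K * max (ENNReal.ofReal (∑' n : ℕ, ‖b n‖)) (dppNorm p b) *
            dpNorm p a := by
  have hp0 : 0 < p := by linarith
  have hC : (2 : ℝ≥0∞) ^ p ≠ ⊤ := ENNReal.rpow_ne_top_of_nonneg hp0.le ENNReal.ofNat_ne_top
  set C : ℝ≥0∞ := 2 ^ p * (3 + 2 ^ p) with hCdef
  have hCtop : C ^ (1 / p) ≠ ⊤ := ENNReal.rpow_ne_top_of_nonneg (by positivity)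
    (ENNReal.mul_ne_top hC (ENNReal.add_ne_top.2 ⟨ENNReal.ofNat_ne_top, hC⟩))
  have hCpos : C ^ (1 / p) ≠ 0 := by
    have : (2 : ℝ≥0∞) ^ p ≠ 0 := by simp [ENNReal.rpow_eq_zero_iff]
    have : C ≠ 0 := mul_ne_zero this (by simp)
    simp [ENNReal.rpow_eq_zero_iff, this, hp0.le]
  refine ⟨(C ^ (1 / p)).toReal, ENNReal.toReal_pos hCpos hCtop, fun b hb hW => ⟨fun a ha => ?_,
    fun a _ => ?_⟩⟩
  · refine ne_top_of_le_ne_top (ENNReal.mul_ne_top (ENNReal.mul_ne_top hC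
      (ENNReal.add_ne_top.2 ⟨?_, ENNReal.mul_ne_top (ENNReal.add_ne_top.2
        ⟨ENNReal.ofNat_ne_top, hC⟩) hW⟩)) ha) (dpSum_conv_le hp a b)
    rw [tsum_nnnorm_eq_ofReal hb]
    exact ENNReal.rpow_ne_top_of_nonneg hp0.le ENNReal.ofReal_ne_top
  · rw [ENNReal.ofReal_toReal hCtop, conv_comm]
    set M := max (ENNReal.ofReal (∑' n : ℕ, ‖b n‖)) (dppNorm p b)
    have hL : (∑' n, (‖b n‖₊ : ℝ≥0∞)) ^ p ≤ M ^ p := by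
      rw [tsum_nnnorm_eq_ofReal hb]
      exact ENNReal.rpow_le_rpow (le_max_left _ _) hp0.le
    have hD : dppSum p b ≤ M ^ p := by
      refine le_trans ?_ (ENNReal.rpow_le_rpow (le_max_right _ _) hp0.le)
      rw [dppNorm, one_div, ENNReal.rpow_inv_rpow hp0.ne']
      exact le_add_self
    have hmain : dpSum p (conv a b) ≤ C * M ^ p * dpSum p a :=
      calc _ ≤ 2 ^ p * (M ^ p + (2 + 2 ^ p) * M ^ p) * dpSum p a :=
            (dpSum_conv_le hp a b).trans (by gcongr)
        _ = _ := by rw [hCdef]; ring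
    have hp1 : 0 ≤ 1 / p := by positivity
    calc dpNorm p (conv a b) ≤ (C * M ^ p * dpSum p a) ^ (1 / p) :=
          ENNReal.rpow_le_rpow hmain hp1
      _ = _ := by
          rw [ENNReal.mul_rpow_of_nonneg _ _ hp1, ENNReal.mul_rpow_of_nonneg _ _ hp1,
            ← ENNReal.rpow_mul, mul_one_div_cancel hp0.ne', ENNReal.rpow_one]
          rfl
end

section
/- Let 1 < p < ∞. The sequence b defined by b_n = 1/n when n = 2^k for some k ∈ ℕ and b_n = 0 otherwise is a multiplier of d_p, yet ∑_{n=0}^∞ 2^{np} · sup_{2ⁿ ≤ k < 2^{n+1}} |b_k|^p = ∞ (i.e., b ∉ d_{pp}). Hence the inclusion of d_{pp} ∩ ℓ¹ into the multiplier algebra of d_p is strict. -/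
open scoped ENNReal NNReal BigOperators

/-- The antitone envelope `n ↦ sup_{k ≥ n} |a_k|^p` appearing in `dpSum`. -/
noncomputable def powTailSup (p : ℝ) (a : ℕ → ℂ) (n : ℕ) : ℝ≥0∞ :=
  ⨆ k ∈ Set.Ici n, (‖a k‖₊ : ℝ≥0∞) ^ p

theorem powTailSup_antitone (p : ℝ) (a : ℕ → ℂ) : Antitone (powTailSup p a) := fun _ _ h =>
  biSup_mono fun _ hk => le_trans h hk

theorem nnnorm_le_powTailSup_rpow {p : ℝ} (hp : 0 < p) (a : ℕ → ℂ) {n k : ℕ} (h : n ≤ k) :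
    (‖a k‖₊ : ℝ≥0∞) ≤ powTailSup p a n ^ p⁻¹ := by
  rw [ENNReal.le_rpow_inv_iff hp]
  exact le_biSup (fun k => (‖a k‖₊ : ℝ≥0∞) ^ p) (Set.mem_Ici.2 h)

/-- A sequence dominated in modulus by an antitone `p`-summable sequence lies in `d_p`. -/
theorem memDp_of_le_antitone {p : ℝ} (hp : 0 < p) {c : ℕ → ℂ} {D : ℕ → ℝ≥0∞} (hD : Antitone D)
    (hc : ∀ n, (‖c n‖₊ : ℝ≥0∞) ≤ D n) (hsum : ∑' n, D n ^ p ≠ ⊤) : MemDp p c := by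
  refine ne_top_of_le_ne_top hsum (ENNReal.tsum_le_tsum fun n => iSup₂_le fun k hk => ?_)
  exact ENNReal.rpow_le_rpow ((hc k).trans (hD hk)) hp.le

theorem tsum_comp_div_two (f : ℕ → ℝ≥0∞) : ∑' n, f (n / 2) = 2 * ∑' n, f n := by
  rw [← (Nat.divModEquiv 2).symm.tsum_eq, ENNReal.tsum_prod']
  have h : ∀ (q : ℕ) (r : Fin 2), ((Nat.divModEquiv 2).symm (q, r)) / 2 = q := fun q r =>
    congrArg Prod.fst ((Nat.divModEquiv 2).apply_symm_apply (q, r))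
  simp_rw [h, tsum_fintype, Finset.sum_const, nsmul_eq_mul, ENNReal.tsum_mul_left]
  simp

theorem tsum_inv_add_one_rpow_ne_top {p : ℝ} (hp : 1 < p) :
    ∑' n : ℕ, (((n : ℝ≥0∞) + 1)⁻¹) ^ p ≠ ⊤ := by
  have hs := (NNReal.summable_nat_add_iff 1).2 (NNReal.summable_rpow_inv.2 hp)
  convert ENNReal.tsum_coe_ne_top_iff_summable.2 hs using 3 with n
  have h : ((n : ℝ≥0) + 1) ≠ 0 := by positivity
  have h' : ((n : ℝ≥0) + 1) ^ p ≠ 0 := (NNReal.rpow_pos (pos_of_ne_zero h)).ne'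
  push_cast
  rw [ENNReal.coe_inv h', ENNReal.coe_rpow_of_ne_zero h, ENNReal.inv_rpow]
  simp

theorem nnnorm_conv_le {a b : ℕ → ℂ} {A : ℕ → ℝ≥0∞}
    (ha : ∀ n k, n ≤ k → (‖a k‖₊ : ℝ≥0∞) ≤ A n) (m : ℕ) :
    (‖conv a b m‖₊ : ℝ≥0∞) ≤ A (m / 2) * ∑' j, (‖b j‖₊ : ℝ≥0∞) +
      A 0 * ∑ j ∈ Finset.range (m + 1) with m < 2 * j, (‖b j‖₊ : ℝ≥0∞) := by
  have hconv : conv a b m = ∑ j ∈ Finset.range (m + 1), a (m - j) * b j := by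
    rw [conv, ← Finset.sum_range_reflect]
    refine Finset.sum_congr rfl fun j hj => ?_
    have := Finset.mem_range.1 hj
    congr 2; omega
  have htri : (‖conv a b m‖₊ : ℝ≥0∞) ≤
      ∑ j ∈ Finset.range (m + 1), (‖a (m - j)‖₊ : ℝ≥0∞) * ‖b j‖₊ := by
    rw [hconv]
    refine (ENNReal.coe_le_coe.2 (nnnorm_sum_le _ _)).trans_eq ?_
    push_cast [nnnorm_mul]
    rfl
  rw [← Finset.sum_filter_add_sum_filter_not _ (fun j => m < 2 * j), add_comm] at htri
  refine htri.trans (add_le_add ?_ ?_)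
  · refine le_trans ?_ (mul_le_mul_right (ENNReal.sum_le_tsum
      (Finset.filter (fun j => ¬ m < 2 * j) (Finset.range (m + 1)))) _)
    rw [Finset.mul_sum]
    refine Finset.sum_le_sum fun j hj => mul_le_mul_left (ha _ _ ?_) _
    have := (Finset.mem_filter.1 hj).2
    omega
  · rw [Finset.mul_sum]
    exact Finset.sum_le_sum fun j _ => mul_le_mul_left (ha _ _ (Nat.zero_le _)) _

theorem tsum_nnnorm_ne_top_of_powers_two {b : ℕ → ℂ}
    (hb : ∀ k : ℕ, (‖b (2 ^ k)‖₊ : ℝ≥0∞) = ((2 : ℝ≥0∞) ^ k)⁻¹)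
    (hb0 : ∀ n : ℕ, (∀ k : ℕ, n ≠ 2 ^ k) → b n = 0) :
    ∑' j, (‖b j‖₊ : ℝ≥0∞) ≠ ⊤ := by
  have hsupp : Function.support (fun j => (‖b j‖₊ : ℝ≥0∞)) ⊆ Set.range (fun k : ℕ => 2 ^ k) := by
    intro n hn
    by_contra h
    exact hn (by simp [hb0 n fun k hk => h ⟨k, hk.symm⟩])
  rw [← (Nat.pow_right_injective le_rfl).tsum_eq hsupp]
  simp_rw [hb, ENNReal.inv_pow]
  rw [ENNReal.tsum_geometric, ENNReal.one_sub_inv_two]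
  simp

theorem sum_upper_half_le_of_powers_two {b : ℕ → ℂ}
    (hb : ∀ k : ℕ, (‖b (2 ^ k)‖₊ : ℝ≥0∞) = ((2 : ℝ≥0∞) ^ k)⁻¹)
    (hb0 : ∀ n : ℕ, (∀ k : ℕ, n ≠ 2 ^ k) → b n = 0) (m : ℕ) :
    ∑ j ∈ Finset.range (m + 1) with m < 2 * j, (‖b j‖₊ : ℝ≥0∞) ≤ 2 * ((m : ℝ≥0∞) + 1)⁻¹ := by
  by_cases h : ∃ k, 2 ^ k ∈ (Finset.range (m + 1)).filter (fun j => m < 2 * j)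
  · obtain ⟨k, hk⟩ := h
    simp only [Finset.mem_filter, Finset.mem_range] at hk
    rw [Finset.sum_eq_single (2 ^ k)]
    · rw [hb, ENNReal.inv_le_iff_inv_le, ENNReal.mul_inv (by simp) (by simp), inv_inv,
        mul_comm, ← div_eq_mul_inv]
      refine ENNReal.div_le_of_le_mul ?_
      have : m + 1 ≤ 2 ^ k * 2 := by omega
      exact_mod_cast this
    · intro j hj hne
      simp only [Finset.mem_filter, Finset.mem_range] at hj
      rw [hb0 j fun l hl => ?_]
      · simp
      · subst hl
        rcases lt_trichotomy k l with hlt | rfl | hlt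
        · have := Nat.pow_le_pow_right two_pos (Nat.succ_le_of_lt hlt)
          rw [pow_succ] at this
          omega
        · exact hne rfl
        · have := Nat.pow_le_pow_right two_pos (Nat.succ_le_of_lt hlt)
          rw [pow_succ] at this
          omega
    · intro hk'
      exact absurd (by simpa using hk) hk'
  · rw [Finset.sum_eq_zero]
    · exact zero_le
    · intro j hj
      simp [hb0 j fun k hk => h ⟨k, hk ▸ hj⟩]

theorem isMultiplier_of_powers_two {p : ℝ} (hp : 1 < p) {b : ℕ → ℂ}
    (hb : ∀ k : ℕ, (‖b (2 ^ k)‖₊ : ℝ≥0∞) = ((2 : ℝ≥0∞) ^ k)⁻¹)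
    (hb0 : ∀ n : ℕ, (∀ k : ℕ, n ≠ 2 ^ k) → b n = 0) : IsMultiplier p b := by
  intro a ha
  have hp0 : 0 < p := zero_lt_one.trans hp
  have hsum : ∑' n, powTailSup p a n ≠ ⊤ := ha
  set A : ℕ → ℝ≥0∞ := fun n => powTailSup p a n ^ p⁻¹ with hA
  have hA0 : A 0 ≠ ⊤ :=
    ENNReal.rpow_ne_top_of_nonneg (inv_nonneg.2 hp0.le) (ENNReal.ne_top_of_tsum_ne_top hsum 0)
  have hAp : ∀ n, A n ^ p = powTailSup p a n := fun n => ENNReal.rpow_inv_rpow hp0.ne' _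
  have hAanti : Antitone A := fun _ _ h =>
    ENNReal.rpow_le_rpow (powTailSup_antitone p a h) (inv_nonneg.2 hp0.le)
  set B := ∑' j, (‖b j‖₊ : ℝ≥0∞) with hB
  have hBtop : B ≠ ⊤ := tsum_nnnorm_ne_top_of_powers_two hb hb0
  refine memDp_of_le_antitone hp0
    (D := fun n => A (n / 2) * B + A 0 * (2 * ((n : ℝ≥0∞) + 1)⁻¹)) ?_ (fun n => ?_) ?_
  · intro n m h
    have h2 := hAanti (Nat.div_le_div_right (c := 2) h)
    have h3 : (n : ℝ≥0∞) ≤ m := by exact_mod_cast h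
    dsimp only
    gcongr
  · exact (nnnorm_conv_le (fun n k h => nnnorm_le_powTailSup_rpow hp0 a h) n).trans
      (add_le_add le_rfl (mul_le_mul_right (sum_upper_half_le_of_powers_two hb hb0 n) _))
  · refine ne_top_of_le_ne_top ?_
      (ENNReal.tsum_le_tsum fun n => ENNReal.rpow_add_le_mul_rpow_add_rpow _ _ hp.le)
    simp_rw [ENNReal.mul_rpow_of_nonneg _ _ hp0.le, hAp]
    rw [ENNReal.tsum_mul_left, ENNReal.tsum_add, ENNReal.tsum_mul_right, ENNReal.tsum_mul_left,
      ENNReal.tsum_mul_left, tsum_comp_div_two]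
    have h2 : (2 : ℝ≥0∞) ^ p ≠ ⊤ := ENNReal.rpow_ne_top_of_nonneg hp0.le (by simp)
    refine ENNReal.mul_ne_top (ENNReal.rpow_ne_top_of_nonneg (by linarith) (by simp))
      (ENNReal.add_ne_top.2 ⟨?_, ?_⟩)
    · exact ENNReal.mul_ne_top (ENNReal.mul_ne_top (by simp) hsum)
        (ENNReal.rpow_ne_top_of_nonneg hp0.le hBtop)
    · exact ENNReal.mul_ne_top (ENNReal.ne_top_of_tsum_ne_top hsum 0)
        (ENNReal.mul_ne_top h2 (tsum_inv_add_one_rpow_ne_top hp))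

theorem dppSum_eq_top_of_powers_two {p : ℝ} (hp : 0 < p) {b : ℕ → ℂ}
    (hb : ∀ k : ℕ, (‖b (2 ^ k)‖₊ : ℝ≥0∞) = ((2 : ℝ≥0∞) ^ k)⁻¹) : dppSum p b = ⊤ := by
  refine top_unique ?_
  rw [← ENNReal.tsum_const_eq_top_of_ne_zero (α := ℕ) (one_ne_zero (α := ℝ≥0∞))]
  refine ENNReal.tsum_le_tsum fun n => ?_
  have hmem : 2 ^ n ∈ Set.Ico (2 ^ n) (2 ^ (n + 1)) :=
    ⟨le_rfl, Nat.pow_lt_pow_right one_lt_two n.lt_succ_self⟩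
  refine le_trans (le_of_eq ?_)
    (mul_le_mul_right (le_biSup (fun k => (‖b k‖₊ : ℝ≥0∞) ^ p) hmem) _)
  rw [hb, ENNReal.rpow_mul, ENNReal.rpow_natCast, ← ENNReal.mul_rpow_of_nonneg _ _ hp.le,
    ENNReal.mul_inv_cancel (by simp) (by simp), ENNReal.one_rpow]

/-- for `1 < p < ∞`, the sequence `b` with `b_n = 1/n` when `n = 2^k` and
`b_n = 0` otherwise is a multiplier of `d_p` but `b ∉ d_{pp}`; hence the inclusion
`d_{pp} ∩ ℓ¹ ⊆ M(d_p)` is strict. -/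
theorem multiplier_not_in_dpp (p : ℝ) (hp : 1 < p) (b : ℕ → ℂ)
    (hb : ∀ k : ℕ, b (2 ^ k) = 1 / ((2 : ℂ) ^ k))
    (hb0 : ∀ n : ℕ, (∀ k : ℕ, n ≠ 2 ^ k) → b n = 0) :
    IsMultiplier p b ∧ dppSum p b = ⊤ := by
  have hnorm : ∀ k : ℕ, (‖b (2 ^ k)‖₊ : ℝ≥0∞) = ((2 : ℝ≥0∞) ^ k)⁻¹ := fun k => by
    rw [hb k, one_div, nnnorm_inv, nnnorm_pow, Complex.nnnorm_ofNat, ENNReal.coe_inv (by simp)]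
    simp
  exact ⟨isMultiplier_of_powers_two hp hnorm hb0,
    dppSum_eq_top_of_powers_two (zero_lt_one.trans hp) hnorm⟩
end
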